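/- arXiv:1704.05124 — 2 statements merged into one kernel-verified Lean document; each statement's English description precedes it below -/
import Mathlib

section
/- The triple (T_k, ε, δ) is a comonad on the category of σ-structures and homomorphisms: in addition to functoriality of T_k and naturality of ε and δ, for every σ-structure A the coassociativity law δ_{T_k A} ∘ δ_A = (T_k δ_A) ∘ δ_A and the counit laws ε_{T_k A} ∘ δ_A = id_{T_k A} and (T_k ε_A) ∘ δ_A = id_{T_k A} hold. -/
/-!
Common definitions: relational signatures, structures, homomorphisms,
the pebbling comonad T_k, positions and strategies, tree decompositions.
-/

/-- A relational signature: a type of relation symbols with arities. -/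
structure Signature where
  Rel : Type
  ar : Rel → ℕ

/-- A σ-structure: a carrier together with an interpretation of each relation symbol. -/
structure Struct (σ : Signature) where
  carrier : Type
  rel : ∀ R : σ.Rel, (Fin (σ.ar R) → carrier) → Prop

/-- Homomorphisms of σ-structures. -/
def IsHom {σ : Signature} (A B : Struct σ) (f : A.carrier → B.carrier) : Prop :=
  ∀ (R : σ.Rel) (t : Fin (σ.ar R) → A.carrier), A.rel R t → B.rel R (fun i => f (t i))

/-- Plays: nonempty finite sequences of moves (pebble index, element). -/
abbrev Play (k : ℕ) (α : Type) : Type := { s : List (Fin k × α) // s ≠ [] }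

/-- The counit ε: the last component of the last move of a play. -/
def Play.eps {k : ℕ} {α : Type} (s : Play k α) : α := (s.1.getLast s.2).2

/-- `Play.Active s t`: s ⊑ t and the pebble index of the last move of s does not
occur in the suffix of s in t. -/
def Play.Active {k : ℕ} {α : Type} (s t : Play k α) : Prop :=
  s.1 <+: t.1 ∧ ∀ m ∈ t.1.drop s.1.length, m.1 ≠ (s.1.getLast s.2).1

/-- The pebbling structure T_k A: a relation holds of a tuple of plays iff they are
pairwise ⊑-comparable — equivalently, all of them are prefixes of a ⊑-greatest one
`t j` — with the pebble index of the last move of each not reused in the corresponding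
suffix, and the underlying relation holds of the last components. -/
def TStruct (k : ℕ) {σ : Signature} (A : Struct σ) : Struct σ where
  carrier := Play k A.carrier
  rel R t := (∃ j, ∀ i, Play.Active (t i) (t j)) ∧ A.rel R (fun i => Play.eps (t i))

/-- The functorial action of T_k on maps: (p,a) ↦ (p, f a) in each move. -/
def Tmap {k : ℕ} {α β : Type} (f : α → β) (s : Play k α) : Play k β :=
  ⟨s.1.map (fun m => (m.1, f m.2)), by simpa using s.2⟩

/-- The (nonempty) prefix of length i+1 of a play. -/
def Play.prefixAt {k : ℕ} {α : Type} (s : Play k α) (i : ℕ) : Play k α :=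
  ⟨s.1.take (i + 1), by
    obtain ⟨h, t, e⟩ := List.exists_cons_of_ne_nil s.2
    simp [e]⟩

/-- The comultiplication δ: sends a play s = [(p₁,a₁),…,(pₙ,aₙ)] to
[(p₁,s₁),…,(pₙ,sₙ)] where sᵢ is the length-i prefix of s. -/
def delta {k : ℕ} {α : Type} (s : Play k α) : Play k (Play k α) :=
  ⟨List.ofFn (fun i : Fin s.1.length => ((s.1.get i).1, Play.prefixAt s i.1)), by
    have h : s.1.length ≠ 0 := by simpa using s.2
    simpa using h⟩

/-- The Kleisli coextension f* of f. -/
def coext {k : ℕ} {α β : Type} (f : Play k α → β) (s : Play k α) : Play k β :=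
  Tmap f (delta s)

/-- The inclusion T_l A → T_k A for l ≤ k, acting as the identity on sequences. -/
def incl {l k : ℕ} (h : l ≤ k) {α : Type} (s : Play l α) : Play k α :=
  ⟨s.1.map (fun m => (Fin.castLE h m.1, m.2)), by simpa using s.2⟩

/-- Configurations Γ_k(A,B): partial functions from pebble indices to pairs. -/
abbrev Conf (k : ℕ) (α β : Type) : Type := Fin k → Option (α × β)

/-- The empty configuration. -/
def Conf.empty {k : ℕ} {α β : Type} : Conf k α β := fun _ => none

/-- Update of a configuration: γ[p ↦ (a,b)]. -/
def Conf.update {k : ℕ} {α β : Type} (γ : Conf k α β) (p : Fin k) (a : α) (b : β) :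
    Conf k α β := Function.update γ p (some (a, b))

/-- Reversal of a configuration. -/
def Conf.rev {k : ℕ} {α β : Type} (γ : Conf k α β) : Conf k β α :=
  fun p => (γ p).map Prod.swap

def revSet {k : ℕ} {α β : Type} (S : Set (Conf k α β)) : Set (Conf k β α) :=
  Conf.rev '' S

/-- The relation R(γ) ⊆ A × B determined by a configuration. -/
def ConfRel {k : ℕ} {α β : Type} (γ : Conf k α β) (a : α) (b : β) : Prop :=
  ∃ p, γ p = some (a, b)

/-- Auxiliary: compute a position by processing Spoiler's moves (`rest`) in order,
Duplicator responding with f applied to the play so far. -/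
def posFrom {k : ℕ} {α β : Type} (f : Play k α → β) :
    List (Fin k × α) → List (Fin k × α) → Conf k α β → Conf k α β
  | _, [], γ => γ
  | pre, (p, a) :: rest, γ =>
      posFrom f (pre ++ [(p, a)]) rest
        (Conf.update γ p a (f ⟨pre ++ [(p, a)], by simp⟩))

/-- position(s, f*(s)): its domain is the set of pebble indices occurring in s, and it
sends p to (a,b) where (p,a) is the last move of s with index p and b is the
corresponding response in f*(s). -/
def positionOf {k : ℕ} {α β : Type} (f : Play k α → β) (s : Play k α) : Conf k α β :=
  posFrom f [] s.1 Conf.empty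

/-- S_f: the set of positions reached when Duplicator follows f, plus ∅. -/
def Sf {k : ℕ} {α β : Type} (f : Play k α → β) : Set (Conf k α β) :=
  { γ | ∃ s : Play k α, γ = positionOf f s } ∪ { Conf.empty }

/-- One update step between configurations. -/
def ConfStep {k : ℕ} {α β : Type} (γ γ' : Conf k α β) : Prop :=
  ∃ p a b, γ' = Conf.update γ p a b

/-- A strategy in positional form: contains ∅, has a Duplicator response for every
Spoiler move at every configuration, and every configuration of it is reachable
from ∅ by updates staying in it. -/
def IsStrategy {k : ℕ} {α β : Type} (S : Set (Conf k α β)) : Prop :=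
  Conf.empty ∈ S ∧
  (∀ γ ∈ S, ∀ (p : Fin k) (a : α), ∃ b, Conf.update γ p a b ∈ S) ∧
  (∀ γ ∈ S, Relation.ReflTransGen (fun x y => y ∈ S ∧ ConfStep x y) Conf.empty γ)

/-- A deterministic (positional) strategy: unique responses. -/
def Deterministic {k : ℕ} {α β : Type} (S : Set (Conf k α β)) : Prop :=
  ∀ γ ∈ S, ∀ (p : Fin k) (a : α), ∃! b, Conf.update γ p a b ∈ S

/-- A configuration is winning if R(γ) is a partial homomorphism. -/
def WinningConf {σ : Signature} (A B : Struct σ) {k : ℕ}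
    (γ : Conf k A.carrier B.carrier) : Prop :=
  ∀ (R : σ.Rel) (tA : Fin (σ.ar R) → A.carrier) (tB : Fin (σ.ar R) → B.carrier),
    (∀ i, ConfRel γ (tA i) (tB i)) → A.rel R tA → B.rel R tB

/-- A set of configurations is winning if all its members are. -/
def WinningSet {σ : Signature} (A B : Struct σ) {k : ℕ}
    (S : Set (Conf k A.carrier B.carrier)) : Prop :=
  ∀ γ ∈ S, WinningConf A B γ

/-- The signature σ extended with a binary symbol I. -/
def WithI (σ : Signature) : Signature :=
  ⟨σ.Rel ⊕ Unit, Sum.elim σ.ar (fun _ => 2)⟩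

/-- An I-structure: a (σ ∪ {I})-structure interpreting I as the identity relation. -/
def IsIStruct {σ : Signature} (A : Struct (WithI σ)) : Prop :=
  ∀ t : Fin 2 → A.carrier, A.rel (Sum.inr ()) t ↔ t 0 = t 1

/-- The one-step functions ψ_{s,p} associated to f : T_k A → B, where s ranges over
plays together with the empty sequence. -/
def psi {k : ℕ} {α β : Type} (f : Play k α → β) (s : List (Fin k × α)) (p : Fin k)
    (a : α) : β := f ⟨s ++ [(p, a)], by simp⟩

/-- A partial isomorphism: a single-valued, injective relation such that both it and
its converse are partial homomorphisms. -/
def IsPartialIso {σ : Signature} (A B : Struct σ) (r : A.carrier → B.carrier → Prop) :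
    Prop :=
  (∀ a b b', r a b → r a b' → b = b') ∧
  (∀ a a' b, r a b → r a' b → a = a') ∧
  (∀ (R : σ.Rel) (tA : Fin (σ.ar R) → A.carrier) (tB : Fin (σ.ar R) → B.carrier),
    (∀ i, r (tA i) (tB i)) → (A.rel R tA ↔ B.rel R tB))

/-- A →ᵏᵢ B: a co-Kleisli morphism all of whose one-step functions are injective. -/
def ArrowI (k : ℕ) {σ : Signature} (A B : Struct σ) : Prop :=
  ∃ f : Play k A.carrier → B.carrier, IsHom (TStruct k A) B f ∧
    ∀ s p, Function.Injective (psi f s p)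

/-- A →ᵏₛ B: a co-Kleisli morphism all of whose one-step functions are surjective. -/
def ArrowS (k : ℕ) {σ : Signature} (A B : Struct σ) : Prop :=
  ∃ f : Play k A.carrier → B.carrier, IsHom (TStruct k A) B f ∧
    ∀ s p, Function.Surjective (psi f s p)

/-- A →ᵏᵦ B: a co-Kleisli morphism with all one-step functions bijective and all
reached positions partial isomorphisms. -/
def ArrowB (k : ℕ) {σ : Signature} (A B : Struct σ) : Prop :=
  ∃ f : Play k A.carrier → B.carrier, IsHom (TStruct k A) B f ∧
    (∀ s p, Function.Bijective (psi f s p)) ∧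
    ∀ s : Play k A.carrier, IsPartialIso A B (ConfRel (positionOf f s))

/-- Isomorphism in the co-Kleisli category of T_k. -/
def CoKIso (k : ℕ) {σ : Signature} (A B : Struct σ) : Prop :=
  ∃ (f : Play k A.carrier → B.carrier) (g : Play k B.carrier → A.carrier),
    IsHom (TStruct k A) B f ∧ IsHom (TStruct k B) A g ∧
    (∀ s : Play k A.carrier, g (coext f s) = Play.eps s) ∧
    (∀ t : Play k B.carrier, f (coext g t) = Play.eps t)

/-- The Gaifman graph adjacency relation of a structure. -/
def Gaifman {σ : Signature} (A : Struct σ) (a b : A.carrier) : Prop :=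
  a ≠ b ∧ ∃ (R : σ.Rel) (t : Fin (σ.ar R) → A.carrier),
    A.rel R t ∧ (∃ i, t i = a) ∧ (∃ i, t i = b)

/-- A coalgebra for the comonad T_k. -/
def IsCoalgebra {σ : Signature} (A : Struct σ) (k : ℕ)
    (f : A.carrier → Play k A.carrier) : Prop :=
  IsHom A (TStruct k A) f ∧ (∀ a, Play.eps (f a) = a) ∧
    (∀ a, delta (f a) = Tmap f (f a))

/-- A tree decomposition of a σ-structure. -/
structure TreeDecomp {σ : Signature} (A : Struct σ) where
  V : Type
  G : SimpleGraph V
  isTree : G.IsTree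
  bag : V → Set A.carrier
  covers_elem : ∀ x : A.carrier, ∃ t, x ∈ bag t
  covers_rel : ∀ (R : σ.Rel) (tup : Fin (σ.ar R) → A.carrier),
    A.rel R tup → ∃ t, ∀ i, tup i ∈ bag t
  bag_connected : ∀ x : A.carrier, (G.induce { t | x ∈ bag t }).Connected

/-- A has a tree decomposition all of whose bags have at most k elements
(i.e. tw(A) < k). -/
def HasWidthUnder {σ : Signature} (A : Struct σ) (k : ℕ) : Prop :=
  ∃ d : TreeDecomp A, ∀ t, (d.bag t).Finite ∧ (d.bag t).ncard ≤ k

/-- The induced substructure on a subset of the carrier. -/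
def induceStruct {σ : Signature} (A : Struct σ) (S : Set A.carrier) : Struct σ where
  carrier := ↥S
  rel R t := A.rel R (fun i => (t i).1)

/-- S carries a core of A: the induced substructure admits a homomorphism from A,
and no proper substructure of it does. -/
def IsCore {σ : Signature} (A : Struct σ) (S : Set A.carrier) : Prop :=
  (∃ h, IsHom A (induceStruct A S) h) ∧
  ∀ S' : Set A.carrier, S' ⊂ S → ¬ ∃ h, IsHom A (induceStruct A S') h

namespace Play

variable {k : ℕ} {α β γ : Type}

@[simp]
theorem length_delta (s : Play k α) : (delta s).1.length = s.1.length := by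
  simp [delta]

theorem getElem_delta (s : Play k α) (i : ℕ) (h : i < (delta s).1.length) :
    (delta s).1[i] = ((s.1[i]'(by simpa using h)).1, s.prefixAt i) := by
  simp [delta]

@[simp]
theorem length_Tmap (f : α → β) (s : Play k α) : (Tmap f s).1.length = s.1.length := by
  simp [Tmap]

theorem getElem_Tmap (f : α → β) (s : Play k α) (i : ℕ) (h : i < (Tmap f s).1.length) :
    (Tmap f s).1[i] =
      ((s.1[i]'(by simpa using h)).1, f (s.1[i]'(by simpa using h)).2) := by
  simp [Tmap]

theorem length_pos (s : Play k α) : 0 < s.1.length :=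
  List.length_pos_iff.mpr s.2

theorem Tmap_id (s : Play k α) : Tmap id s = s := by
  apply Subtype.ext
  simp [Tmap]

theorem Tmap_comp (f : α → β) (g : β → γ) (s : Play k α) :
    Tmap (g ∘ f) s = Tmap g (Tmap f s) := by
  apply Subtype.ext
  simp [Tmap]

theorem getLast_Tmap (f : α → β) (s : Play k α) :
    (Tmap f s).1.getLast (Tmap f s).2 = ((s.1.getLast s.2).1, f (s.1.getLast s.2).2) := by
  simp [Tmap]

theorem eps_Tmap (f : α → β) (s : Play k α) : eps (Tmap f s) = f (eps s) := by
  simp [eps, getLast_Tmap]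

theorem getLast_delta (s : Play k α) :
    (delta s).1.getLast (delta s).2 = ((s.1.getLast s.2).1, s) := by
  have hs := s.length_pos
  rw [List.getLast_eq_getElem, getElem_delta, List.getLast_eq_getElem]
  refine Prod.ext ?_ (Subtype.ext ?_)
  · simp
  · exact List.take_of_length_le (by simp; omega)

theorem eps_delta (s : Play k α) : eps (delta s) = s := by
  simp [eps, getLast_delta]

theorem eps_prefixAt (s : Play k α) (i : ℕ) (h : i < s.1.length) :
    eps (s.prefixAt i) = s.1[i].2 := by
  have hlen : min (i + 1) s.1.length = i + 1 := by omega
  simp [eps, prefixAt, List.getLast_eq_getElem, hlen]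

theorem prefixAt_Tmap (f : α → β) (s : Play k α) (i : ℕ) :
    (Tmap f s).prefixAt i = Tmap f (s.prefixAt i) := by
  apply Subtype.ext
  simp [prefixAt, Tmap, List.map_take]

theorem prefixAt_prefixAt (s : Play k α) {i j : ℕ} (h : j ≤ i) :
    (s.prefixAt i).prefixAt j = s.prefixAt j := by
  apply Subtype.ext
  simp [prefixAt, List.take_take, h]

theorem prefixAt_delta (s : Play k α) (i : ℕ) :
    (delta s).prefixAt i = delta (s.prefixAt i) := by
  apply Subtype.ext
  refine List.ext_getElem (by simp [prefixAt]) fun j h₁ h₂ => ?_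
  have hj : j < i + 1 := by simp [prefixAt] at h₁; omega
  rw [getElem_delta, prefixAt_prefixAt s (Nat.lt_succ_iff.mp hj)]
  simp [prefixAt, getElem_delta]

theorem Tmap_eps_delta (s : Play k α) : Tmap eps (delta s) = s := by
  apply Subtype.ext
  refine List.ext_getElem (by simp) fun i h₁ h₂ => ?_
  simp [getElem_Tmap, getElem_delta, eps_prefixAt s i h₂]

theorem delta_Tmap (f : α → β) (s : Play k α) :
    Tmap (Tmap f) (delta s) = delta (Tmap f s) := by
  apply Subtype.ext
  refine List.ext_getElem (by simp) fun i h₁ h₂ => ?_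
  simp [getElem_Tmap, getElem_delta, prefixAt_Tmap]

theorem delta_delta (s : Play k α) : delta (delta s) = Tmap delta (delta s) := by
  apply Subtype.ext
  refine List.ext_getElem (by simp) fun i h₁ h₂ => ?_
  simp [getElem_Tmap, getElem_delta, prefixAt_delta]

theorem Active.Tmap {s t : Play k α} (h : Active s t) (f : α → β) :
    Active (Tmap f s) (Tmap f t) := by
  refine ⟨h.1.map _, fun m hm => ?_⟩
  rw [getLast_Tmap]
  rw [length_Tmap] at hm
  simp only [_root_.Tmap, ← List.map_drop, List.mem_map] at hm
  obtain ⟨m, hm, rfl⟩ := hm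
  exact h.2 m hm

theorem map_fst_delta (s : Play k α) : (delta s).1.map Prod.fst = s.1.map Prod.fst :=
  List.ext_getElem (by simp) fun i h₁ h₂ => by simp [getElem_delta]

theorem prefixAt_eq_of_prefix {s t : Play k α} (h : s.1 <+: t.1) {i : ℕ}
    (hi : i < s.1.length) : s.prefixAt i = t.prefixAt i := by
  obtain ⟨u, hu⟩ := h
  apply Subtype.ext
  simp only [prefixAt, ← hu]
  exact (List.take_append_of_le_length hi).symm

theorem Active.delta {s t : Play k α} (h : Active s t) : Active (delta s) (delta t) := by
  refine ⟨?_, fun m hm => ?_⟩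
  · rw [List.prefix_iff_getElem]
    refine ⟨by simpa using h.1.length_le, fun i hi => ?_⟩
    rw [length_delta] at hi
    rw [getElem_delta, getElem_delta, prefixAt_eq_of_prefix h.1 hi, h.1.getElem hi]
  · rw [getLast_delta]
    rw [length_delta] at hm
    have hfst := List.mem_map_of_mem (f := Prod.fst) hm
    rw [List.map_drop, map_fst_delta, ← List.map_drop, List.mem_map] at hfst
    obtain ⟨m', hm', he⟩ := hfst
    exact he ▸ h.2 m' hm'

end Play

theorem IsHom.Tmap {σ : Signature} {k : ℕ} {A B : Struct σ} {f : A.carrier → B.carrier}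
    (hf : IsHom A B f) : IsHom (TStruct k A) (TStruct k B) (Tmap f) := by
  rintro R t ⟨⟨j, hj⟩, hR⟩
  refine ⟨⟨j, fun i => (hj i).Tmap f⟩, ?_⟩
  exact (congrArg (B.rel R) (funext fun i => Play.eps_Tmap f (t i))).mpr (hf R _ hR)

theorem isHom_delta {σ : Signature} {k : ℕ} (A : Struct σ) :
    IsHom (TStruct k A) (TStruct k (TStruct k A)) delta := by
  intro R t ht
  obtain ⟨j, hj⟩ := ht.1
  refine ⟨⟨j, fun i => (hj i).delta⟩, ?_⟩
  exact (congrArg ((TStruct k A).rel R) (funext fun i => Play.eps_delta (t i))).mpr ht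

/-- (T_k, ε, δ) is a comonad on the category of σ-structures:
functoriality of T_k, naturality of ε and δ, coassociativity, and the counit laws. -/
theorem pebbling_comonad {σ : Signature} (k : ℕ) (hk : 0 < k) :
    -- T_k is a functor: preserves homomorphisms, identities and composition
    (∀ (A B : Struct σ) (f : A.carrier → B.carrier), IsHom A B f →
      IsHom (TStruct k A) (TStruct k B) (Tmap f)) ∧
    (∀ (A : Struct σ) (s : Play k A.carrier), Tmap (id : A.carrier → A.carrier) s = s) ∧
    (∀ (A B C : Struct σ) (f : A.carrier → B.carrier) (g : B.carrier → C.carrier),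
      IsHom A B f → IsHom B C g →
      ∀ s : Play k A.carrier, Tmap (g ∘ f) s = Tmap g (Tmap f s)) ∧
    -- ε and δ are homomorphisms and natural
    (∀ A : Struct σ, IsHom (TStruct k A) A Play.eps) ∧
    (∀ A : Struct σ, IsHom (TStruct k A) (TStruct k (TStruct k A)) delta) ∧
    (∀ (A B : Struct σ) (f : A.carrier → B.carrier), IsHom A B f →
      ∀ s : Play k A.carrier, f (Play.eps s) = Play.eps (Tmap f s)) ∧
    (∀ (A B : Struct σ) (f : A.carrier → B.carrier), IsHom A B f →
      ∀ s : Play k A.carrier, Tmap (Tmap f) (delta s) = delta (Tmap f s)) ∧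
    -- coassociativity: δ_{T_k A} ∘ δ_A = (T_k δ_A) ∘ δ_A
    (∀ (A : Struct σ) (s : Play k A.carrier), delta (delta s) = Tmap delta (delta s)) ∧
    -- counit laws: ε_{T_k A} ∘ δ_A = id and (T_k ε_A) ∘ δ_A = id
    (∀ (A : Struct σ) (s : Play k A.carrier), Play.eps (delta s) = s) ∧
    (∀ (A : Struct σ) (s : Play k A.carrier), Tmap Play.eps (delta s) = s) := by
  exact ⟨fun _ _ _ hf => hf.Tmap, fun _ => Play.Tmap_id,
    fun _ _ _ f g _ _ => Play.Tmap_comp f g, fun _ _ _ h => h.2, isHom_delta,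
    fun _ _ f _ s => (Play.eps_Tmap f s).symm, fun _ _ f _ => Play.delta_Tmap f,
    fun _ => Play.delta_delta, fun _ => Play.eps_delta, fun _ => Play.Tmap_eps_delta⟩
end

section
/- For σ-structures A and B and any positive integer k: if there exists an injective homomorphism A → T_k B, then tw(A) < k, i.e., A admits a tree decomposition in which every bag has at most k elements. -/
/-- The tree of finite sequences, in which each sequence is joined to its one-step extensions. -/
def listTree (α : Type) : SimpleGraph (List α) where
  Adj s t := (∃ m, t = s ++ [m]) ∨ ∃ m, s = t ++ [m]
  symm := ⟨fun _ _ h => h.symm⟩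
  loopless := ⟨fun s h => by simp at h⟩

lemma listTree_adj_append {α : Type} (s : List α) (m : α) : (listTree α).Adj s (s ++ [m]) :=
  Or.inl ⟨m, rfl⟩

lemma listTree_connected (α : Type) : (listTree α).Connected := by
  have h (s : List α) : (listTree α).Reachable [] s := by
    induction s using List.reverseRecOn with
    | nil => exact .refl _
    | append_singleton s m ih => exact ih.trans (listTree_adj_append s m).reachable
  exact ⟨fun s t => (h s).symm.trans (h t)⟩

/-- A vertex property that is constant along edges is constant on connected components. -/
lemma SimpleGraph.Reachable.iff_of_forall_adj {V : Type*} {G : SimpleGraph V} {P : V → Prop}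
    (hP : ∀ x y, G.Adj x y → (P x ↔ P y)) {u v : V} (h : G.Reachable u v) : P u ↔ P v := by
  obtain ⟨w⟩ := h
  induction w with
  | nil => rfl
  | cons hadj _ ih => exact (hP _ _ hadj).trans ih

lemma listTree_isBridge_append {α : Type} (s : List α) (m : α) :
    (listTree α).IsBridge s(s, s ++ [m]) := by
  rw [SimpleGraph.isBridge_iff]
  intro hr
  have step (x : List α) (n : α) (h : ¬ (x = s ∧ n = m)) :
      s ++ [m] <+: x ↔ s ++ [m] <+: x ++ [n] := by
    rw [List.prefix_concat_iff]
    refine ⟨Or.inr, fun h' => h'.resolve_left fun e => h ?_⟩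
    simpa [eq_comm] using e
  have key := hr.iff_of_forall_adj (P := fun x => s ++ [m] <+: x) fun x y hxy => by
    rw [SimpleGraph.deleteEdges_adj] at hxy
    obtain ⟨⟨n, rfl⟩ | ⟨n, rfl⟩, hne⟩ := hxy
    · exact step x n (by rintro ⟨rfl, rfl⟩; simp at hne)
    · exact (step y n (by rintro ⟨rfl, rfl⟩; simp [Sym2.eq_swap] at hne)).symm
  have := (key.2 (List.prefix_refl _)).length_le
  simp at this

lemma listTree_isTree (α : Type) : (listTree α).IsTree := by
  refine ⟨listTree_connected α, SimpleGraph.isAcyclic_iff_forall_adj_isBridge.2 ?_⟩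
  rintro s t (⟨m, rfl⟩ | ⟨m, rfl⟩)
  · exact listTree_isBridge_append s m
  · rw [Sym2.eq_swap]
    exact listTree_isBridge_append t m

/-- `Play.Active` with the second play allowed to be empty. -/
def Play.ActiveIn {k : ℕ} {β : Type} (s : Play k β) (t : List (Fin k × β)) : Prop :=
  s.1 <+: t ∧ ∀ m ∈ t.drop s.1.length, m.1 ≠ (s.1.getLast s.2).1

namespace Play.ActiveIn

variable {k : ℕ} {β : Type} {s s' : Play k β} {t : List (Fin k × β)}

lemma self (s : Play k β) : s.ActiveIn s.1 := by simp [Play.ActiveIn]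

lemma of_append (hs : s.1 <+: t) {u : List (Fin k × β)} (h : s.ActiveIn (t ++ u)) :
    s.ActiveIn t := by
  refine ⟨hs, fun m hm => h.2 m ?_⟩
  rw [List.drop_append_of_le_length hs.length_le]
  exact List.mem_append_left _ hm

/-- Of two comparable plays ending with the same pebble, the longer one reuses the pebble of
the shorter one. -/
lemma eq_of_prefix (h : s.ActiveIn t) (h' : s'.ActiveIn t) (hss' : s.1 <+: s'.1)
    (hp : (s.1.getLast s.2).1 = (s'.1.getLast s'.2).1) : s = s' := by
  obtain ⟨u, hu⟩ := hss'
  obtain ⟨v, hv⟩ := h'.1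
  rcases eq_or_ne u [] with rfl | hne
  · exact Subtype.ext (by simpa using hu)
  · refine absurd hp.symm (h.2 (s'.1.getLast s'.2) ?_)
    have hlast : s'.1.getLast s'.2 = u.getLast hne := by
      simp only [← hu, List.getLast_append_of_ne_nil _ hne]
    rw [hlast, ← hv, ← hu, List.append_assoc, List.drop_left]
    exact List.mem_append_left _ (List.getLast_mem hne)

lemma eq_of_pebble_eq (h : s.ActiveIn t) (h' : s'.ActiveIn t)
    (hp : (s.1.getLast s.2).1 = (s'.1.getLast s'.2).1) : s = s' :=
  (List.prefix_or_prefix_of_prefix h.1 h'.1).elim (h.eq_of_prefix h' · hp)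
    fun hle => (h'.eq_of_prefix h hle hp.symm).symm

end Play.ActiveIn

lemma listTree_induce_activeIn_connected {k : ℕ} {β : Type} (s : Play k β) :
    ((listTree (Fin k × β)).induce {t | s.ActiveIn t}).Connected := by
  have h (t : List (Fin k × β)) (ht : s.ActiveIn t) :
      ((listTree (Fin k × β)).induce {t | s.ActiveIn t}).Reachable
        ⟨s.1, .self s⟩ ⟨t, ht⟩ := by
    induction t using List.reverseRecOn with
    | nil => exact absurd (List.prefix_nil.1 ht.1) s.2
    | append_singleton t m ih =>
      rcases List.prefix_concat_iff.1 ht.1 with e | hs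
      · exact (Subtype.ext e : (⟨s.1, .self s⟩ : {t | s.ActiveIn t}) = ⟨t ++ [m], ht⟩) ▸ .refl _
      · refine (ih (ht.of_append hs)).trans (SimpleGraph.Adj.reachable ?_)
        exact listTree_adj_append t m
  exact { preconnected := fun x y => (h x.1 x.2).symm.trans (h y.1 y.2)
          nonempty := ⟨⟨s.1, .self s⟩⟩ }

/-- The tree decomposition induced by a homomorphism into `TStruct k B`: the bag of a sequence
consists of the elements whose play is active in it. -/
def pebblingTreeDecomp {σ : Signature} {A B : Struct σ} {k : ℕ} {f : A.carrier → Play k B.carrier}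
    (hf : IsHom A (TStruct k B) f) : TreeDecomp A where
  V := List (Fin k × B.carrier)
  G := listTree _
  isTree := listTree_isTree _
  bag t := {x | (f x).ActiveIn t}
  covers_elem x := ⟨(f x).1, .self (f x)⟩
  covers_rel R tup h := by
    obtain ⟨⟨j, hj⟩, -⟩ := hf R tup h
    exact ⟨(f (tup j)).1, hj⟩
  bag_connected x := listTree_induce_activeIn_connected (f x)

/-- if there is an injective homomorphism A → T_k B then tw(A) < k,
i.e. A admits a tree decomposition in which every bag has at most k elements. -/
theorem injective_hom_treewidth {σ : Signature} (A B : Struct σ) (k : ℕ) (hk : 0 < k)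
    (h : ∃ f : A.carrier → Play k B.carrier,
      Function.Injective f ∧ IsHom A (TStruct k B) f) :
    HasWidthUnder A k := by
  obtain ⟨f, hinj, hf⟩ := h
  refine ⟨pebblingTreeDecomp hf, fun t => ?_⟩
  let bag : Set A.carrier := {x | (f x).ActiveIn t}
  change bag.Finite ∧ bag.ncard ≤ k
  let pebble (x : A.carrier) : Fin k := ((f x).1.getLast (f x).2).1
  have hpebble : Set.InjOn pebble bag :=
    fun x hx y hy hxy => hinj (hx.eq_of_pebble_eq hy hxy)
  refine ⟨Set.Finite.of_finite_image (Set.toFinite _) hpebble, ?_⟩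
  rw [← hpebble.ncard_image]
  simpa using Set.ncard_le_card (pebble '' bag)
end
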